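/- Let (β_n)_{n≥0} be positive real numbers with limsup_n β_{n+1}/β_n ≤ 1 and sup_n β_n/β_{n+1} < ∞. Let H²(β) be the Hilbert space of complex-valued analytic functions f(z) = ∑_{n≥0} a_n zⁿ on 𝔻 with ‖f‖² := ∑_{n≥0} |a_n|²/β_n² < ∞. Let P be a nonzero complex polynomial and let H_P := {z ↦ P(z)f(z) : f ∈ H²(β)} be the Hilbert space with inner product ⟨Pf, Pg⟩_{H_P} := ⟨f, g⟩_{H²(β)} (well defined since f ↦ Pf is injective on analytic functions). If the multiplication operator M_z is bounded on H_P ((M_z g)(w) = w · g(w)), then M_z* is hypercyclic on H_P if and only if liminf_n β_n = 0. -/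

import Mathlib

open Metric Filter ContinuousLinearMap

noncomputable section

/-- The realization of an element `f` of `H²(β)` (given by its Taylor coefficients
`coeff f`) as the `H_P`-function `z ↦ P(z)·f(z)`, where `P` is a complex polynomial and
`f(z) = ∑ (coeff f n) zⁿ`. -/
def iotaP {HB : Type*}
    [NormedAddCommGroup HB] [InnerProductSpace ℂ HB] [CompleteSpace HB]
    (p : Polynomial ℂ) (coeff : HB →ₗ[ℂ] (ℕ → ℂ)) (f : HB) : ℂ → ℂ :=
  fun z => p.eval z * ∑' n : ℕ, coeff f n * z ^ n

open Topology in
/-- A power series converging on the unit disc whose sum vanishes on a punctured neighbourhood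
of the origin has zero coefficients. -/
theorem powerSeries_coeff_eq_zero {e : ℕ → ℂ}
    (hs : ∀ z ∈ ball (0 : ℂ) 1, Summable fun n : ℕ => e n * z ^ n)
    (h : ∀ᶠ z in 𝓝[≠] (0 : ℂ), ∑' n : ℕ, e n * z ^ n = 0) : e = 0 := by
  set q := FormalMultilinearSeries.ofScalars ℂ e with hq
  have hsum : ∀ z, q.sum z = ∑' n : ℕ, e n * z ^ n := fun z => by
    simp [hq, FormalMultilinearSeries.sum, mul_comm]
  have hr : 0 < q.radius := by
    have hhalf : Summable fun n : ℕ => e n * (1 / 2 : ℂ) ^ n :=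
      hs _ (by norm_num [mem_ball_zero_iff])
    refine lt_of_lt_of_le ?_ (q.le_radius_of_tendsto (r := 1 / 2) (l := 0) ?_)
    · norm_num
    · refine squeeze_zero (fun n => by positivity) (fun n => ?_)
        (tendsto_zero_iff_norm_tendsto_zero.1 hhalf.tendsto_atTop_zero)
      rw [norm_mul, norm_pow]
      gcongr
      · exact (FormalMultilinearSeries.ofScalars_norm (E := ℂ) e n).le
      · norm_num
  have hpow : HasFPowerSeriesAt q.sum q 0 := (q.hasFPowerSeriesOnBall hr).hasFPowerSeriesAt
  have hev : ∀ᶠ z in 𝓝 (0 : ℂ), q.sum z = 0 := by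
    refine (AnalyticAt.frequently_zero_iff_eventually_zero hpow.analyticAt).1 ?_
    exact (h.mono fun z hz => (hsum z).trans hz).frequently
  have hzero := (hpow.congr (g := 0) hev).eq_zero
  funext n
  have h1 := (FormalMultilinearSeries.ofScalars_norm (E := ℂ) e n)
  rw [← hq, hzero] at h1
  simpa using h1.symm

/-- Birkhoff's transitivity criterion. -/
theorem exists_dense_orbit_of_transitive {X : Type*} [TopologicalSpace X] [BaireSpace X]
    [SecondCountableTopology X] [Nonempty X] (F : ℕ → X → X) (hF : ∀ m, Continuous (F m))
    (htrans : ∀ U V : Set X, IsOpen U → IsOpen V → U.Nonempty → V.Nonempty →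
      ∃ m, ∃ x ∈ U, F m x ∈ V) :
    ∃ x, Dense (Set.range fun m => F m x) := by
  have hB := TopologicalSpace.isBasis_countableBasis X
  have hdense : Dense (⋂ V ∈ TopologicalSpace.countableBasis X, ⋃ m, F m ⁻¹' V) := by
    refine dense_biInter_of_isOpen
      (fun V hV => isOpen_iUnion fun m => (hB.isOpen hV).preimage (hF m))
      (TopologicalSpace.countable_countableBasis X) fun V hV => ?_
    rw [dense_iff_inter_open]
    intro U hU hUne
    obtain ⟨m, x, hxU, hxV⟩ := htrans U V hU (hB.isOpen hV) hUne
      (TopologicalSpace.nonempty_of_mem_countableBasis hV)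
    exact ⟨x, hxU, Set.mem_iUnion.2 ⟨m, hxV⟩⟩
  obtain ⟨x, hx⟩ := hdense.nonempty
  refine ⟨x, hB.dense_iff.2 fun V hV _ => ?_⟩
  obtain ⟨m, hm⟩ := Set.mem_iUnion.1 (Set.mem_iInter₂.1 hx V hV)
  exact ⟨F m x, hm, m, rfl⟩

/-- An operator acting as a backward shift on a sequence `d` with dense span is hypercyclic as
soon as arbitrarily long blocks of `d`, arbitrarily far out, are arbitrarily small. -/
theorem hypercyclic_of_backward_shift {X : Type*} [NormedAddCommGroup X] [NormedSpace ℂ X]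
    [CompleteSpace X] [TopologicalSpace.SeparableSpace X] (A : X →L[ℂ] X) (d : ℕ → X)
    (h0 : A (d 0) = 0) (hsucc : ∀ n, A (d (n + 1)) = d n)
    (hspan : Dense (Submodule.span ℂ (Set.range d) : Set X))
    (hsmall : ∀ ε > 0, ∀ N : ℕ, ∃ m ≥ N, ∀ n ≤ N, ‖d (n + m)‖ < ε) :
    ∃ g : X, Dense (Set.range fun m : ℕ => (A ^ m) g) := by
  have : SecondCountableTopology X := UniformSpace.secondCountable_of_separable X
  have hshift : ∀ m n, (A ^ m) (d (n + m)) = d n := by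
    intro m
    induction m with
    | zero => simp
    | succ m ih => intro n; rw [pow_succ, mul_apply_eq_comp, ← add_assoc, hsucc, ih]
  have hkill : ∀ m n, n < m → (A ^ m) (d n) = 0 := by
    intro m
    induction m with
    | zero => simp
    | succ m ih =>
      intro n hn
      rw [pow_succ, mul_apply_eq_comp]
      cases n with
      | zero => rw [h0, map_zero]
      | succ n => rw [hsucc, ih n (by omega)]
  refine exists_dense_orbit_of_transitive (fun m => ⇑(A ^ m)) (fun m => (A ^ m).continuous) ?_
  intro U V hU hV hUne hVne
  obtain ⟨u, huU, hu⟩ := hspan.inter_open_nonempty U hU hUne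
  obtain ⟨v, hvV, hv⟩ := hspan.inter_open_nonempty V hV hVne
  obtain ⟨a, rfl⟩ := Finsupp.mem_span_range_iff_exists_finsupp.1 hu
  obtain ⟨c, rfl⟩ := Finsupp.mem_span_range_iff_exists_finsupp.1 hv
  obtain ⟨r, hr, hball⟩ := Metric.isOpen_iff.1 hU _ huU
  set K : ℝ := ∑ n ∈ c.support, ‖c n‖ with hK
  have hK0 : 0 ≤ K := Finset.sum_nonneg fun _ _ => norm_nonneg _
  obtain ⟨m, hm, hd⟩ := hsmall (r / (K + 1)) (by positivity)
    (a.support.sup id + c.support.sup id + 1)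
  refine ⟨m, (a.sum fun n x => x • d n) + c.sum fun n x => x • d (n + m), hball ?_, ?_⟩
  · rw [mem_ball, dist_eq_norm, add_sub_cancel_left]
    calc ‖c.sum fun n x => x • d (n + m)‖
        ≤ ∑ n ∈ c.support, ‖c n‖ * (r / (K + 1)) := by
          refine norm_sum_le_of_le _ fun n hn => ?_
          rw [norm_smul]
          have : n ≤ c.support.sup id := Finset.le_sup (f := id) hn
          exact mul_le_mul_of_nonneg_left (hd n (by omega)).le (norm_nonneg _)
      _ = K * (r / (K + 1)) := by rw [← Finset.sum_mul]
      _ < r := by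
          rw [mul_div_assoc', div_lt_iff₀ (by positivity)]
          nlinarith
  · have h1 : (A ^ m) (a.sum fun n x => x • d n) = 0 := by
      rw [Finsupp.sum, map_sum]
      refine Finset.sum_eq_zero fun n hn => ?_
      have : n ≤ a.support.sup id := Finset.le_sup (f := id) hn
      rw [map_smul, hkill m n (by omega), smul_zero]
    have h2 : (A ^ m) (c.sum fun n x => x • d (n + m)) = c.sum fun n x => x • d n := by
      simp [Finsupp.sum, map_sum, hshift]
    simpa only [map_add, h1, h2, zero_add] using hvV

/-- If `u (n + 1) = T (u n)` is a bounded nonzero orbit, then the adjoint of `T` is not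
hypercyclic. -/
theorem not_hypercyclic_adjoint_of_bounded_orbit {H : Type*} [NormedAddCommGroup H]
    [InnerProductSpace ℂ H] [CompleteSpace H] (T : H →L[ℂ] H) (u : H) (hu : u ≠ 0) {M : ℝ}
    (hM : ∀ m : ℕ, ‖(T ^ m) u‖ ≤ M) (g : H) :
    ¬ Dense (Set.range fun m : ℕ => ((adjoint T) ^ m) g) := by
  intro hg
  have hadj : ∀ m : ℕ, (adjoint T) ^ m = adjoint (T ^ m) := fun m => by
    simp only [← star_eq_adjoint, star_pow]
  have hbdd : ∀ x : H, ‖inner ℂ u x‖ ≤ M * ‖g‖ := by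
    intro x
    refine hg.induction (P := fun x => ‖inner ℂ u x‖ ≤ M * ‖g‖) ?_ ?_ x
    · rintro _ ⟨m, rfl⟩
      dsimp only
      rw [hadj, adjoint_inner_right]
      exact (norm_inner_le_norm _ _).trans (mul_le_mul_of_nonneg_right (hM m) (norm_nonneg _))
    · exact isClosed_le (by fun_prop) continuous_const
  have hu2 : 0 < ‖u‖ ^ 2 := by positivity
  have h := hbdd ((((M * ‖g‖ + 1) / ‖u‖ ^ 2 : ℝ) : ℂ) • u)
  rw [inner_smul_right, inner_self_eq_norm_sq_to_K] at h
  have hcast : (((M * ‖g‖ + 1) / ‖u‖ ^ 2 : ℝ) : ℂ) * ((‖u‖ : ℂ)) ^ 2 = ((M * ‖g‖ + 1 : ℝ) : ℂ) := by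
    rw [← Complex.ofReal_pow, ← Complex.ofReal_mul, div_mul_cancel₀ _ hu2.ne']
  rw [RCLike.ofReal_eq_complex_ofReal, hcast, Complex.norm_real] at h
  linarith [le_abs_self (M * ‖g‖ + 1), Real.norm_eq_abs (M * ‖g‖ + 1)]

/-- A Hilbert space normed by weighted square-summable coefficients has a Hilbert basis whose
coordinates are the normalized coefficients. -/
theorem exists_hilbertBasis_of_coeff {H : Type*} [NormedAddCommGroup H] [InnerProductSpace ℂ H]
    [CompleteSpace H] (β : ℕ → ℝ) (hβpos : ∀ n, 0 < β n) (coeff : H →ₗ[ℂ] (ℕ → ℂ))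
    (hnorm : ∀ f : H, HasSum (fun n : ℕ => ‖coeff f n‖ ^ 2 / (β n) ^ 2) (‖f‖ ^ 2))
    (hsurj : ∀ a : ℕ → ℂ, Summable (fun n : ℕ => ‖a n‖ ^ 2 / (β n) ^ 2) →
      ∃ f : H, coeff f = a) :
    ∃ b : HilbertBasis ℕ ℂ H, ∀ f n, b.repr f n = coeff f n / β n := by
  have hterm : ∀ (x : ℂ) n, ‖x / (β n : ℂ)‖ ^ 2 = ‖x‖ ^ 2 / (β n) ^ 2 := fun x n => by
    rw [norm_div, Complex.norm_real, div_pow, Real.norm_eq_abs, sq_abs]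
  have htwo : (0 : ℝ) < (2 : ENNReal).toReal := by norm_num
  have hmem : ∀ f : H, Memℓp (fun n => coeff f n / (β n : ℂ)) 2 := fun f => by
    rw [memℓp_gen_iff htwo]
    simpa only [ENNReal.toReal_ofNat, Real.rpow_ofNat, hterm] using (hnorm f).summable
  let L : H →ₗᵢ[ℂ] lp (fun _ : ℕ => ℂ) 2 :=
    { toFun := fun f => ⟨fun n => coeff f n / (β n : ℂ), hmem f⟩
      map_add' := fun f g => by
        ext n
        change coeff (f + g) n / (β n : ℂ) = coeff f n / β n + coeff g n / β n
        rw [map_add, Pi.add_apply, add_div]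
      map_smul' := fun c f => by ext n; simp [mul_div_assoc]
      norm_map' := fun f => by
        have h := lp.norm_rpow_eq_tsum htwo
          (⟨fun n => coeff f n / (β n : ℂ), hmem f⟩ : lp (fun _ : ℕ => ℂ) 2)
        simp only [ENNReal.toReal_ofNat, Real.rpow_ofNat, hterm, (hnorm f).tsum_eq] at h
        exact (sq_eq_sq₀ (norm_nonneg _) (norm_nonneg _)).1 h }
  have hL : Function.Surjective L := fun x => by
    have hx := (memℓp_gen_iff htwo).1 (lp.memℓp x)
    obtain ⟨f, hf⟩ := hsurj (fun n => x n * β n) (by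
      refine hx.congr fun n => ?_
      rw [← hterm, mul_div_cancel_right₀ _ (Complex.ofReal_ne_zero.2 (hβpos n).ne')]
      simp)
    refine ⟨f, ?_⟩
    ext n
    change coeff f n / (β n : ℂ) = x n
    rw [hf, mul_div_cancel_right₀ _ (Complex.ofReal_ne_zero.2 (hβpos n).ne')]
  exact ⟨HilbertBasis.ofRepr (LinearIsometryEquiv.ofSurjective L hL), fun f n => rfl⟩

open Topology in
/-- The operator corresponding to multiplication by `z` on `H_P` shifts the coefficients. -/
theorem coeff_mul_z {H : Type*} [NormedAddCommGroup H] [InnerProductSpace ℂ H] [CompleteSpace H]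
    (coeff : H →ₗ[ℂ] (ℕ → ℂ))
    (hconv : ∀ f : H, ∀ z ∈ ball (0 : ℂ) 1, Summable (fun n : ℕ => coeff f n * z ^ n))
    (p : Polynomial ℂ) (hp : p ≠ 0) (Mz : H →L[ℂ] H)
    (hMz : ∀ f : H, ∀ w ∈ ball (0 : ℂ) 1,
      iotaP p coeff (Mz f) w = w * iotaP p coeff f w) (f : H) :
    coeff (Mz f) 0 = 0 ∧ ∀ n, coeff (Mz f) (n + 1) = coeff f n := by
  set s : ℕ → ℂ := fun n => Nat.casesOn n 0 (coeff f) with hs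
  have hsS : ∀ z ∈ ball (0 : ℂ) 1, HasSum (fun n => s n * z ^ n) (z * ∑' n, coeff f n * z ^ n) := by
    intro z hz
    rw [← hasSum_nat_add_iff' 1]
    have h0 : ∑ i ∈ Finset.range 1, s i * z ^ i = 0 := by simp [hs]
    rw [h0, sub_zero]
    refine ((hconv f z hz).hasSum.mul_left z).congr_fun fun n => ?_
    change coeff f n * z ^ (n + 1) = z * (coeff f n * z ^ n)
    ring
  have hzero : coeff (Mz f) - s = 0 := by
    refine powerSeries_coeff_eq_zero (fun z hz => ?_) ?_
    · simpa only [Pi.sub_apply, sub_mul] using (hconv (Mz f) z hz).sub (hsS z hz).summable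
    · have hroot : ∀ᶠ z in 𝓝[≠] (0 : ℂ), p.eval z ≠ 0 := by
        refine nhdsNE_le_cofinite _ ?_
        refine (p.roots.toFinset.finite_toSet).subset fun z hz => ?_
        simpa [hp] using hz
      have hball : ∀ᶠ z in 𝓝[≠] (0 : ℂ), z ∈ ball (0 : ℂ) 1 :=
        nhdsWithin_le_nhds (ball_mem_nhds _ one_pos)
      filter_upwards [hroot, hball] with z hz hz1
      have h := hMz f z hz1
      simp only [iotaP] at h
      rw [mul_left_comm] at h
      simp only [Pi.sub_apply, sub_mul]
      rw [(hconv (Mz f) z hz1).tsum_sub (hsS z hz1).summable, (hsS z hz1).tsum_eq,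
        mul_left_cancel₀ hz h, sub_self]
  have heq := sub_eq_zero.1 hzero
  exact ⟨congrFun heq 0, fun n => congrFun heq (n + 1)⟩

/-- A positive sequence with bounded backward ratios and zero lower limit has arbitrarily small
blocks of any length. -/
theorem exists_small_block {β : ℕ → ℝ} (hβpos : ∀ n, 0 < β n) {C : ℝ}
    (hC : ∀ n, β n / β (n + 1) ≤ C)
    (hfreq : ∀ δ > 0, ∀ N : ℕ, ∃ k ≥ N, β k < δ) {ε : ℝ} (hε : 0 < ε) (N : ℕ) :
    ∃ m ≥ N, ∀ n ≤ N, β (n + m) < ε := by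
  set D := max C 1 with hD
  have hD1 : 1 ≤ D := le_max_right _ _
  have hstep : ∀ j n, β n ≤ D ^ j * β (n + j) := by
    intro j
    induction j with
    | zero => simp
    | succ j ih =>
      intro n
      have h : β (n + j) ≤ D * β (n + j + 1) :=
        (div_le_iff₀ (hβpos _)).1 ((hC _).trans (le_max_left _ _))
      calc β n ≤ D ^ j * β (n + j) := ih n
        _ ≤ D ^ j * (D * β (n + j + 1)) := by gcongr
        _ = D ^ (j + 1) * β (n + (j + 1)) := by rw [← add_assoc]; ring
  obtain ⟨k, hk, hkε⟩ := hfreq (ε / D ^ N) (by positivity) (2 * N)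
  refine ⟨k - N, by omega, fun n hn => ?_⟩
  have h := hstep (N - n) (n + (k - N))
  rw [show n + (k - N) + (N - n) = k by omega] at h
  calc β (n + (k - N)) ≤ D ^ (N - n) * β k := h
    _ ≤ D ^ N * β k := by
        have := (hβpos k).le
        gcongr
        omega
    _ < ε := by rwa [lt_div_iff₀' (by positivity)] at hkε

/-- A positive sequence has lower limit zero iff it takes arbitrarily small values arbitrarily
far out. -/
theorem liminf_eq_zero_iff {β : ℕ → ℝ} (hβpos : ∀ n, 0 < β n) :
    liminf (fun n : ℕ => ((β n : ℝ) : EReal)) atTop = 0 ↔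
      ∀ δ > 0, ∀ N : ℕ, ∃ k ≥ N, β k < δ := by
  have hnonneg : 0 ≤ liminf (fun n : ℕ => ((β n : ℝ) : EReal)) atTop :=
    le_liminf_of_le (by isBoundedDefault)
      (Eventually.of_forall fun n => EReal.coe_nonneg.2 (hβpos n).le)
  constructor
  · intro h δ hδ N
    have hlt : liminf (fun n : ℕ => ((β n : ℝ) : EReal)) atTop < (δ : EReal) := by
      rw [h]; exact_mod_cast hδ
    obtain ⟨k, hk, hkδ⟩ := frequently_atTop.1
      (frequently_lt_of_liminf_lt (by isBoundedDefault) hlt) N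
    exact ⟨k, hk, EReal.coe_lt_coe_iff.1 hkδ⟩
  · intro h
    refine le_antisymm (EReal.le_of_forall_lt_iff_le.1 fun δ hδ => ?_) hnonneg
    refine liminf_le_of_frequently_le (frequently_atTop.2 fun N => ?_) (by isBoundedDefault)
    obtain ⟨k, hk, hkδ⟩ := h δ (by exact_mod_cast hδ) N
    exact ⟨k, hk, by exact_mod_cast hkδ.le⟩

/-- Let `H²(β)` be the weighted Hardy space of analytic functions
`f(z) = ∑ aₙ zⁿ` on the unit disc with `‖f‖² = ∑ |aₙ|²/βₙ²`, where `βₙ > 0`,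
`limsup β_{n+1}/β_n ≤ 1` and `sup β_n/β_{n+1} < ∞`. Let `P` be a nonzero complex
polynomial and `H_P = {Pf : f ∈ H²(β)}` with `⟨Pf, Pg⟩ = ⟨f, g⟩`. If the multiplication
operator `M_z` is bounded on `H_P`, then `M_z*` is hypercyclic on `H_P` if and only if
`liminf_n β_n = 0`. -/
theorem stmt19 {HB : Type*}
    [NormedAddCommGroup HB] [InnerProductSpace ℂ HB] [CompleteSpace HB]
    [TopologicalSpace.SeparableSpace HB]
    (β : ℕ → ℝ) (hβpos : ∀ n, 0 < β n)
    (hβ1 : limsup (fun n : ℕ => ((β (n + 1) / β n : ℝ) : EReal)) atTop ≤ 1)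
    (hβ2 : ∃ C : ℝ, ∀ n, β n / β (n + 1) ≤ C)
    (coeff : HB →ₗ[ℂ] (ℕ → ℂ))
    (hcoeff_inj : Function.Injective coeff)
    (hnorm : ∀ f : HB, HasSum (fun n : ℕ => ‖coeff f n‖ ^ 2 / (β n) ^ 2) (‖f‖ ^ 2))
    (hsurj : ∀ a : ℕ → ℂ, Summable (fun n : ℕ => ‖a n‖ ^ 2 / (β n) ^ 2) →
      ∃ f : HB, coeff f = a)
    (hconv : ∀ f : HB, ∀ z ∈ ball (0 : ℂ) 1, Summable (fun n : ℕ => coeff f n * z ^ n))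
    (p : Polynomial ℂ) (hp : p ≠ 0)
    (Mz : HB →L[ℂ] HB)
    (hMz : ∀ f : HB, ∀ w ∈ ball (0 : ℂ) 1,
      iotaP p coeff (Mz f) w = w * iotaP p coeff f w) :
    (∃ g : HB, Dense (Set.range fun m : ℕ => ((adjoint Mz) ^ m) g)) ↔
      liminf (fun n : ℕ => ((β n : ℝ) : EReal)) atTop = 0 := by
  obtain ⟨C, hC⟩ := hβ2
  have hβ0 : ∀ n, (β n : ℂ) ≠ 0 := fun n => Complex.ofReal_ne_zero.2 (hβpos n).ne'
  obtain ⟨b, hb⟩ := exists_hilbertBasis_of_coeff β hβpos coeff hnorm hsurj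
  have hcoeff : ∀ f n, coeff f n = β n * inner ℂ (b n) f := fun f n => by
    rw [← b.repr_apply_apply, hb, mul_div_cancel₀ _ (hβ0 n)]
  have hbb : ∀ k n, inner ℂ (b k) (b n) = if k = n then (1 : ℂ) else 0 :=
    orthonormal_iff_ite.1 b.orthonormal
  have hshift := coeff_mul_z coeff hconv p hp Mz hMz
  have hMb : ∀ n, Mz (((β n : ℂ)⁻¹) • b n) = ((β (n + 1) : ℂ)⁻¹) • b (n + 1) := by
    intro n
    apply hcoeff_inj
    funext k
    cases k with
    | zero => rw [(hshift _).1, hcoeff, inner_smul_right, hbb]; simp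
    | succ k =>
      rw [(hshift _).2, hcoeff, hcoeff, inner_smul_right, inner_smul_right, hbb, hbb]
      by_cases hkn : k = n
      · subst hkn; simp [hβ0]
      · simp [hkn]
  rw [liminf_eq_zero_iff hβpos]
  constructor
  · rintro ⟨g, hg⟩
    by_contra! hcon
    obtain ⟨δ, hδ, N, hN⟩ := hcon
    have hpow : ∀ m, (Mz ^ m) (((β 0 : ℂ)⁻¹) • b 0) = ((β m : ℂ)⁻¹) • b m := by
      intro m
      induction m with
      | zero => simp
      | succ m ih => rw [pow_succ', mul_apply_eq_comp, ih, hMb]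
    have hnormpow : ∀ m, ‖(Mz ^ m) (((β 0 : ℂ)⁻¹) • b 0)‖ = (β m)⁻¹ := fun m => by
      rw [hpow, norm_smul, b.orthonormal.1 m, norm_inv, Complex.norm_real, Real.norm_eq_abs,
        abs_of_pos (hβpos m), mul_one]
    refine not_hypercyclic_adjoint_of_bounded_orbit Mz (((β 0 : ℂ)⁻¹) • b 0) ?_
      (M := δ⁻¹ + ∑ n ∈ Finset.range N, (β n)⁻¹) (fun m => ?_) g hg
    · exact smul_ne_zero (inv_ne_zero (hβ0 0)) (b.orthonormal.ne_zero 0)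
    · rw [hnormpow]
      have hpos : ∀ n ∈ Finset.range N, 0 ≤ (β n)⁻¹ := fun n _ => (inv_pos.2 (hβpos n)).le
      rcases lt_or_ge m N with hm | hm
      · have := Finset.single_le_sum hpos (Finset.mem_range.2 hm)
        have := inv_pos.2 hδ
        linarith
      · have := inv_anti₀ hδ (hN m hm)
        have := Finset.sum_nonneg hpos
        linarith
  · intro hfreq
    have hMb' : ∀ n, Mz (b n) = ((β n : ℂ) * (β (n + 1) : ℂ)⁻¹) • b (n + 1) := fun n => by
      rw [mul_smul, ← hMb, map_smul, smul_inv_smul₀ (hβ0 n)]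
    have hext : ∀ x y : HB, (∀ k, inner ℂ (b k) x = inner ℂ (b k) y) → x = y := fun x y h => by
      apply b.repr.injective
      ext k
      rw [b.repr_apply_apply, b.repr_apply_apply, h]
    refine hypercyclic_of_backward_shift (adjoint Mz) (fun n => (β n : ℂ) • b n) ?_ ?_ ?_ ?_
    · refine hext _ _ fun k => ?_
      rw [adjoint_inner_right, hMb', inner_smul_left, inner_smul_right, hbb]
      simp
    · refine fun n => hext _ _ fun k => ?_
      rw [adjoint_inner_right, hMb', inner_smul_left, inner_smul_right, inner_smul_right, hbb, hbb]
      by_cases hkn : k = n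
      · subst hkn; simp [hβ0]
      · simp [hkn]
    · refine (Submodule.dense_iff_topologicalClosure_eq_top.2 b.dense_span).mono ?_
      refine Submodule.span_le.2 ?_
      rintro _ ⟨n, rfl⟩
      rw [← inv_smul_smul₀ (hβ0 n) (b n)]
      exact Submodule.smul_mem _ _ (Submodule.subset_span ⟨n, rfl⟩)
    · intro ε hε N
      obtain ⟨m, hm, h⟩ := exists_small_block hβpos hC hfreq hε N
      refine ⟨m, hm, fun n hn => ?_⟩
      rw [norm_smul, b.orthonormal.1, mul_one, Complex.norm_real, Real.norm_eq_abs,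
        abs_of_pos (hβpos _)]
      exact h n hn
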